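/- arXiv:2311.18753 — 3 statements merged into one kernel-verified Lean document; each statement's English description precedes it below -/
import Mathlib

section
/- For every integer r ≥ 4, there are infinitely many pairs (n,e) of positive integers with t_{r−1}(n) < e ≤ C(n,2) such that the family H_2*(n,e) contains a graph that is not isomorphic to any graph in H_1*(n,e). -/
/-- Number of edges of a (simple) graph. -/
noncomputable def edgeCnt {V : Type*} (G : SimpleGraph V) : ℕ := G.edgeSet.ncard

/-- `NK G r` is the number of `r`-cliques in `G`. -/
noncomputable def NK {V : Type*} (G : SimpleGraph V) (r : ℕ) : ℕ :=
  {s : Finset V | G.IsNClique r s}.ncard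

/-- Clique count with an integer index: `N(K_r, G) = 0` for `r < 0`. -/
noncomputable def NKZ {V : Type*} (G : SimpleGraph V) (r : ℤ) : ℕ :=
  if r < 0 then 0 else NK G r.toNat

/-- `tur s n` is the number of edges of the Turán graph `T_s(n)`. -/
noncomputable def tur (s n : ℕ) : ℕ := edgeCnt (SimpleGraph.turanGraph n s)

/-- `kk n e = k(n,e)`, the least `s ≥ 1` with `t_s(n) ≥ e`. -/
noncomputable def kk (n e : ℕ) : ℕ := sInf {s : ℕ | 1 ≤ s ∧ e ≤ tur s n}

/-- `a_k*(n,e)`, the least `a ≥ 1` with `a(n-a) + t_{k-1}(n-a) ≥ e`. -/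
noncomputable def aLast (n e : ℕ) : ℕ :=
  sInf {a : ℕ | 1 ≤ a ∧ e ≤ a * (n - a) + tur (kk n e - 1) (n - a)}

/-- `aStar n e i = a_i*(n,e)` for `i ∈ [k]` (1-indexed):
the unique vector with `a_k* = aLast n e`, `a_1* + ⋯ + a_{k-1}* = n - a_k*` and
`a_1* ≥ ⋯ ≥ a_{k-1}* ≥ a_1* - 1`. -/
noncomputable def aStar (n e i : ℕ) : ℕ :=
  if i = kk n e then aLast n e
  else (n - aLast n e) / (kk n e - 1) +
    (if i ≤ (n - aLast n e) % (kk n e - 1) then 1 else 0)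

/-- `m*(n,e) = Σ_{i<j} a_i* a_j* - e` (as a natural number). -/
noncomputable def mStar (n e : ℕ) : ℕ :=
  (∑ p ∈ (Finset.Icc 1 (kk n e)).powersetCard 2, ∏ i ∈ p, aStar n e i) - e

/-- `m*(n,e) = Σ_{i<j} a_i* a_j* - e` (as an integer). -/
noncomputable def mStarZ (n e : ℕ) : ℤ :=
  (∑ p ∈ (Finset.Icc 1 (kk n e)).powersetCard 2, ∏ i ∈ p, (aStar n e i : ℤ)) - (e : ℤ)

/-- `h_r*(n,e) = Σ_{I ⊆ [k], |I|=r} Π_{i∈I} a_i* - m* Σ_{I' ⊆ [k-2], |I'|=r-2} Π_{j∈I'} a_j*`. -/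
noncomputable def hStar (n e r : ℕ) : ℤ :=
  (∑ I ∈ (Finset.Icc 1 (kk n e)).powersetCard r, ∏ i ∈ I, (aStar n e i : ℤ)) -
    (mStar n e : ℤ) *
      ∑ I ∈ (Finset.Icc 1 (kk n e - 2)).powersetCard (r - 2), ∏ i ∈ I, (aStar n e i : ℤ)

/-- Membership in the family `K(n,e)`: `(n,e)`-graphs obtained from a complete multipartite
graph by adding a triangle-free graph into one part. -/
def MemK (n e : ℕ) (G : SimpleGraph (Fin n)) : Prop :=
  edgeCnt G = e ∧
  ∃ (c : Fin n → ℕ) (j₀ : ℕ),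
    (∀ u v, c u ≠ c v → G.Adj u v) ∧
    (∀ u v, G.Adj u v → c u = c v → c u = j₀) ∧
    (G.induce {v | c v = j₀}).CliqueFree 3

/-- Membership in the family `H_1(n,e)`: `(n,e)`-graphs obtained from a complete
`(k-1)`-partite graph by adding a triangle-free graph into one part. -/
def MemH1 (n e : ℕ) (G : SimpleGraph (Fin n)) : Prop :=
  edgeCnt G = e ∧
  ∃ (c : Fin n → Fin (kk n e - 1)) (j₀ : Fin (kk n e - 1)),
    (∀ u v, c u ≠ c v → G.Adj u v) ∧
    (∀ u v, G.Adj u v → c u = c v → c u = j₀) ∧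
    (G.induce {v | c v = j₀}).CliqueFree 3

/-- Membership in the family `H_0(n,e)`: `(n,e)`-graphs obtained from a complete
`(k-1)`-partite graph by adding a (possibly empty) triangle-free graph into each part. -/
def MemH0 (n e : ℕ) (G : SimpleGraph (Fin n)) : Prop :=
  edgeCnt G = e ∧
  ∃ c : Fin n → Fin (kk n e - 1),
    (∀ u v, c u ≠ c v → G.Adj u v) ∧
    ∀ j, (G.induce {v | c v = j}).CliqueFree 3

/-- Membership (up to isomorphism) in the family `H_1*(n,e)`: graphs obtained from the
complete `k`-partite graph with part sizes `a_1*, …, a_k*` by replacing, for some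
`i ∈ [k-1]` (with `i = k-1` if `m* > 0`), the complete bipartite graph between parts `i`
and `k` by an arbitrary triangle-free graph on the union of these two parts with
`a_i* a_k* - m*` edges. -/
def MemH1star (n e : ℕ) (G : SimpleGraph (Fin n)) : Prop :=
  edgeCnt G = e ∧
  ∃ (c : Fin n → ℕ) (i : ℕ),
    (∀ v, c v ∈ Finset.Icc 1 (kk n e)) ∧
    (∀ j ∈ Finset.Icc 1 (kk n e), {v | c v = j}.ncard = aStar n e j) ∧
    i ∈ Finset.Icc 1 (kk n e - 1) ∧
    (0 < mStar n e → i = kk n e - 1) ∧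
    (∀ u v, c u ≠ c v →
      (c u ∉ ({i, kk n e} : Set ℕ) ∨ c v ∉ ({i, kk n e} : Set ℕ)) → G.Adj u v) ∧
    (∀ u v, G.Adj u v → c u = c v → c u = i ∨ c u = kk n e) ∧
    (G.induce {v | c v = i ∨ c v = kk n e}).CliqueFree 3

/-- Membership (up to isomorphism) in the family `H_2*(n,e)`. -/
def MemH2star (n e : ℕ) (G : SimpleGraph (Fin n)) : Prop :=
  (MemH1star n e G ∧ G.Colorable (kk n e)) ∨
  (edgeCnt G = e ∧
   ∃ (c : Fin n → ℕ) (sz : ℕ → ℕ) (f : Fin n → ℕ),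
     ((∀ j, sz j = aStar n e j) ∨
      (mStar n e = 0 ∧ aStar n e (kk n e) + 2 ≤ aStar n e 1 ∧
       (∀ j ∈ Finset.Icc 1 (kk n e - 2), sz j = aStar n e (j + 1)) ∧
       sz (kk n e - 1) = aStar n e 1 - 1 ∧ sz (kk n e) = aStar n e (kk n e) + 1)) ∧
     (∀ v, c v ∈ Finset.Icc 1 (kk n e)) ∧
     (∀ j ∈ Finset.Icc 1 (kk n e), {v | c v = j}.ncard = sz j) ∧
     (∀ u v, G.Adj u v → c u ≠ c v) ∧
     (∀ u v, c u ≠ c v → ¬ G.Adj u v → c v = kk n e →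
        c u ∈ Finset.Icc 1 (kk n e - 1) ∧ sz (c u) = sz (kk n e - 1) ∧ c u = f v) ∧
     (∀ u v, c u ≠ c v → ¬ G.Adj u v → c u = kk n e ∨ c v = kk n e))

/-- Partial sums of the part sizes `a_i*`. -/
noncomputable def csum (n e j : ℕ) : ℕ := ∑ i ∈ Finset.Icc 1 j, aStar n e i

/-- The part (in `[k]`) of the vertex with index `v` in the canonical construction. -/
noncomputable def partOf (n e v : ℕ) : ℕ := sInf {j : ℕ | v < csum n e j}

/-- The graph `H*(n,e)`: the complete `k`-partite graph with part sizes `a_1*, …, a_k*`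
minus an `m*`-edge star whose centre lies in part `k` and whose leaves lie in part `k-1`. -/
noncomputable def HstarG (n e : ℕ) : SimpleGraph (Fin n) :=
  SimpleGraph.fromRel (fun u v =>
    partOf n e u ≠ partOf n e v ∧
    ¬ (((u : ℕ) = csum n e (kk n e - 1) ∧
          csum n e (kk n e - 2) ≤ (v : ℕ) ∧
          (v : ℕ) < csum n e (kk n e - 2) + mStar n e) ∨
       ((v : ℕ) = csum n e (kk n e - 1) ∧
          csum n e (kk n e - 2) ≤ (u : ℕ) ∧
          (u : ℕ) < csum n e (kk n e - 2) + mStar n e)))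

/-- `g_r(n,e)`: the minimum number of `r`-cliques among all graphs with `n` vertices and
`e` edges. -/
noncomputable def gMin (n e r : ℕ) : ℕ :=
  sInf {N : ℕ | ∃ G : SimpleGraph (Fin n), edgeCnt G = e ∧ NK G r = N}

theorem edgeCnt_eq_card_edgeFinset {V : Type*} [Fintype V] (G : SimpleGraph V)
    [Fintype G.edgeSet] : edgeCnt G = G.edgeFinset.card := by
  rw [edgeCnt, ← SimpleGraph.coe_edgeFinset, Set.ncard_coe_finset]

theorem edgeCnt_le_tur {n s : ℕ} (hs : 0 < s) {G : SimpleGraph (Fin n)}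
    (hG : G.CliqueFree (s + 1)) : edgeCnt G ≤ tur s n := by
  classical
  rw [tur, edgeCnt_eq_card_edgeFinset, edgeCnt_eq_card_edgeFinset]
  convert (SimpleGraph.isTuranMaximal_turanGraph (n := n) hs).2 hG

theorem tur_mono {n s t : ℕ} (hs : 0 < s) (hst : s ≤ t) : tur s n ≤ tur t n :=
  edgeCnt_le_tur (hs.trans_le hst)
    ((SimpleGraph.turanGraph_cliqueFree hs).mono (Nat.succ_le_succ hst))

theorem tur_add_self (p n : ℕ) :
    tur (p + 1) (n + (p + 1)) = tur (p + 1) n + n * p + (p + 1).choose 2 := by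
  rw [tur, tur, edgeCnt_eq_card_edgeFinset, edgeCnt_eq_card_edgeFinset,
    SimpleGraph.card_edgeFinset_turanGraph_add, Nat.add_sub_cancel]

theorem tur_of_le {n s : ℕ} (h : n ≤ s) : tur s n = n.choose 2 := by
  classical
  rw [tur, SimpleGraph.turanGraph_eq_top.2 (Or.inr h), edgeCnt_eq_card_edgeFinset,
    SimpleGraph.card_edgeFinset_top_eq_card_choose_two, Fintype.card_fin]

theorem two_mul_tur {p t : ℕ} (ht : t ≤ p + 1) (a : ℕ) :
    2 * tur (p + 1) ((p + 1) * a + t) =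
      p * ((p + 1) * a ^ 2 + 2 * a * t) + 2 * t.choose 2 := by
  induction a with
  | zero => simp [tur_of_le ht]
  | succ a ih =>
    have hc : 2 * (p + 1).choose 2 = (p + 1) * p := by
      rw [Nat.choose_two_right, Nat.add_sub_cancel,
        Nat.mul_div_cancel' (by simpa [mul_comm] using (Nat.even_mul_succ_self p).two_dvd)]
    rw [show (p + 1) * (a + 1) + t = ((p + 1) * a + t) + (p + 1) by ring, tur_add_self]
    linear_combination ih + hc

/-- The block graph with blocks `[ja, (j+1)a)`: distinct blocks are completely joined, except that
two disjoint edges, from the first vertices of the first two blocks to the first two vertices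
of block `q`, are missing. -/
def twoEdgesRemoved (q a n : ℕ) : SimpleGraph (Fin n) where
  Adj u v := u.val / a ≠ v.val / a ∧
    ¬ (u.val = 0 ∧ v.val = q * a) ∧ ¬ (v.val = 0 ∧ u.val = q * a) ∧
    ¬ (u.val = a ∧ v.val = q * a + 1) ∧ ¬ (v.val = a ∧ u.val = q * a + 1)
  symm := ⟨by intro u v h; tauto⟩
  loopless := ⟨by intro u h; exact h.1 rfl⟩

theorem card_block {q a n j : ℕ} (ha : 0 < a) (hn : q * a ≤ n) (hj : j < q) :
    (Finset.univ.filter fun v : Fin n => v.val / a = j).card = a := by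
  have h : (Finset.univ.filter fun v : Fin n => v.val / a = j).map Fin.valEmbedding =
      Finset.Ico (j * a) (j * a + a) := by
    ext x
    have hx : x / a = j ↔ j * a ≤ x ∧ x < j * a + a := by
      rw [Nat.div_eq_iff ha]; omega
    have hle : (j + 1) * a ≤ q * a := Nat.mul_le_mul_right a hj
    simp only [Finset.mem_map, Finset.mem_filter, Finset.mem_univ, true_and,
      Fin.valEmbedding_apply, Finset.mem_Ico, ← hx]
    refine ⟨?_, fun h => ⟨⟨x, ?_⟩, h, rfl⟩⟩
    · rintro ⟨v, hv, rfl⟩; exact hv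
    · have := (hx.1 h).2
      linarith
  rw [← Finset.card_map, h, Nat.card_Ico, Nat.add_sub_cancel_left]

theorem card_last_block {q a : ℕ} (ha : 2 ≤ a) :
    (Finset.univ.filter fun v : Fin (q * a + 2) => v.val / a = q).card = 2 := by
  have h : (Finset.univ.filter fun v : Fin (q * a + 2) => v.val / a = q).map
      Fin.valEmbedding = Finset.Ico (q * a) (q * a + 2) := by
    ext x
    have hx : x / a = q ↔ q * a ≤ x ∧ x < q * a + a := by
      rw [Nat.div_eq_iff (by omega)]; omega
    simp only [Finset.mem_map, Finset.mem_filter, Finset.mem_univ, true_and,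
      Fin.valEmbedding_apply, Finset.mem_Ico]
    refine ⟨?_, fun h => ⟨⟨x, h.2⟩, hx.2 (by omega), rfl⟩⟩
    rintro ⟨v, hv, rfl⟩
    exact ⟨(hx.1 hv).1, v.2⟩
  rw [← Finset.card_map, h, Nat.card_Ico, Nat.add_sub_cancel_left]

theorem block_le {q a : ℕ} (ha : 2 ≤ a) (v : Fin (q * a + 2)) : v.val / a ≤ q := by
  rw [Nat.div_le_iff_le_mul_add_pred (by omega)]
  have := v.2
  rw [mul_comm a q]; omega

theorem card_same_block {q a : ℕ} (ha : 2 ≤ a) :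
    (Finset.univ.filter fun x : Fin (q * a + 2) × Fin (q * a + 2) =>
      x.1.val / a = x.2.val / a).card = q * a ^ 2 + 4 := by
  rw [Finset.card_eq_sum_card_fiberwise (f := fun x => x.1.val / a)
    (t := Finset.range (q + 1))
    (fun x _ => by simpa [Nat.lt_succ_iff] using block_le ha x.1)]
  have hfib : ∀ j, (Finset.filter (fun x : Fin (q * a + 2) × Fin (q * a + 2) => x.1.val / a = j)
      (Finset.univ.filter fun x => x.1.val / a = x.2.val / a)).card =
      (Finset.univ.filter fun v : Fin (q * a + 2) => v.val / a = j).card ^ 2 := by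
    intro j
    rw [sq, ← Finset.card_product]
    congr 1
    ext x
    simp only [Finset.mem_filter, Finset.mem_univ, true_and, Finset.mem_product]
    grind
  simp only [hfib]
  rw [Finset.sum_range_succ, card_last_block ha,
    Finset.sum_congr rfl (g := fun _ => a ^ 2) fun j hj => by
      rw [card_block (by omega) (by omega) (Finset.mem_range.1 hj)]]
  simp

theorem card_two_swapped_pairs {α : Type*} [DecidableEq α] {x y z w : α} (hxy : x ≠ y)
    (hxz : x ≠ z) (hxw : x ≠ w) (hzw : z ≠ w) :
    ({(x, y), (y, x), (z, w), (w, z)} : Finset (α × α)).card = 4 := by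
  rw [Finset.card_insert_of_notMem, Finset.card_insert_of_notMem, Finset.card_insert_of_notMem,
    Finset.card_singleton] <;> simp only [Finset.mem_insert, Finset.mem_singleton, Prod.mk.injEq] <;>
    tauto

theorem two_mul_edgeCnt_twoEdgesRemoved {q a : ℕ} (hq : 2 ≤ q) (ha : 2 ≤ a) :
    2 * edgeCnt (twoEdgesRemoved q a (q * a + 2)) + (q * a ^ 2 + 4) + 4 =
      (q * a + 2) ^ 2 := by
  classical
  have hqa : 2 * a ≤ q * a := Nat.mul_le_mul_right a hq
  have hdiv : q * a / a = q := Nat.mul_div_cancel _ (by omega)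
  have hdiv' : (q * a + 1) / a = q := by rw [Nat.div_eq_iff (by omega)]; omega
  have hself : a / a = 1 := Nat.div_self (by omega)
  rw [edgeCnt_eq_card_edgeFinset, SimpleGraph.two_mul_card_edgeFinset, ← card_same_block ha]
  obtain ⟨v₀, hv₀⟩ : ∃ v : Fin (q * a + 2), v.val = 0 := ⟨⟨0, by omega⟩, rfl⟩
  obtain ⟨v₁, hv₁⟩ : ∃ v : Fin (q * a + 2), v.val = a := ⟨⟨a, by omega⟩, rfl⟩
  obtain ⟨w₀, hw₀⟩ : ∃ v : Fin (q * a + 2), v.val = q * a := ⟨⟨q * a, by omega⟩, rfl⟩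
  obtain ⟨w₁, hw₁⟩ : ∃ v : Fin (q * a + 2), v.val = q * a + 1 := ⟨⟨q * a + 1, by omega⟩, rfl⟩
  obtain ⟨R, hRdef⟩ : ∃ R : Finset (Fin (q * a + 2) × Fin (q * a + 2)),
    R = {(v₀, w₀), (w₀, v₀), (v₁, w₁), (w₁, v₁)} := ⟨_, rfl⟩
  have hR : R.card = 4 := by
    rw [hRdef]
    apply card_two_swapped_pairs <;> rw [ne_eq, Fin.ext_iff] <;> omega
  have hmemR : ∀ u v : Fin (q * a + 2), (u, v) ∈ R ↔
      (u.val = 0 ∧ v.val = q * a) ∨ (u.val = q * a ∧ v.val = 0) ∨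
      (u.val = a ∧ v.val = q * a + 1) ∨ (u.val = q * a + 1 ∧ v.val = a) := by
    intro u v
    simp only [hRdef, Finset.mem_insert, Finset.mem_singleton, Prod.mk.injEq, Fin.ext_iff,
      hv₀, hv₁, hw₀, hw₁]
  have hdisj : Disjoint (Finset.univ.filter fun x : Fin (q * a + 2) × Fin (q * a + 2) =>
      x.1.val / a = x.2.val / a) R := by
    rw [Finset.disjoint_left]
    rintro ⟨u, v⟩ h hr
    simp only [Finset.mem_filter, Finset.mem_univ, true_and] at h
    rcases (hmemR u v).1 hr with ⟨h1, h2⟩ | ⟨h1, h2⟩ | ⟨h1, h2⟩ | ⟨h1, h2⟩ <;>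
      rw [h1, h2] at h <;> simp only [hdiv, hdiv', hself, Nat.zero_div] at h <;> omega
  have hcompl : (Finset.univ.filter fun x : Fin (q * a + 2) × Fin (q * a + 2) =>
      ¬ (twoEdgesRemoved q a (q * a + 2)).Adj x.1 x.2) =
      (Finset.univ.filter fun x => x.1.val / a = x.2.val / a) ∪ R := by
    ext ⟨u, v⟩
    rw [Finset.mem_union, hmemR, Finset.mem_filter, Finset.mem_filter]
    simp only [Finset.mem_univ, true_and, twoEdgesRemoved]
    tauto
  have hc := Finset.card_filter_add_card_filter_not (s := Finset.univ)
    (fun x : Fin (q * a + 2) × Fin (q * a + 2) =>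
      (twoEdgesRemoved q a (q * a + 2)).Adj x.1 x.2)
  rw [hcompl, Finset.card_union_of_disjoint hdisj, hR, Finset.card_univ, Fintype.card_prod,
    Fintype.card_fin, ← sq, ← add_assoc] at hc
  exact hc

theorem twoEdgesRemoved_colorable {q a : ℕ} (ha : 2 ≤ a) :
    (twoEdgesRemoved q a (q * a + 2)).Colorable (q + 1) :=
  ⟨SimpleGraph.Coloring.mk (fun v => ⟨v.val / a, Nat.lt_succ_of_le (block_le ha v)⟩)
    fun h he => h.1 (congrArg Fin.val he)⟩

theorem not_memH1star_twoEdgesRemoved {q a : ℕ} (hq : 2 ≤ q) (ha : 2 ≤ a) (e : ℕ) :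
    ¬ MemH1star (q * a + 2) e (twoEdgesRemoved q a (q * a + 2)) := by
  rintro ⟨-, c, i, -, -, -, -, hjoin, hindep, hfree⟩
  have hqa : 2 * a ≤ q * a := Nat.mul_le_mul_right a hq
  have hdiv : q * a / a = q := Nat.mul_div_cancel _ (by omega)
  have hdiv' : (q * a + 1) / a = q := by rw [Nat.div_eq_iff (by omega)]; omega
  have hself : a / a = 1 := Nat.div_self (by omega)
  have hself' : (a + 1) / a = 1 := by rw [Nat.div_eq_iff (by omega)]; omega
  have hzero : 0 / a = 0 := Nat.zero_div a
  let G := twoEdgesRemoved q a (q * a + 2)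
  let v₀ : Fin (q * a + 2) := ⟨0, by omega⟩
  let v₁ : Fin (q * a + 2) := ⟨a, by omega⟩
  let v₂ : Fin (q * a + 2) := ⟨a + 1, by omega⟩
  let w₀ : Fin (q * a + 2) := ⟨q * a, by omega⟩
  let w₁ : Fin (q * a + 2) := ⟨q * a + 1, by omega⟩
  set P : Fin (q * a + 2) → Prop := fun v => c v = i ∨ c v = kk (q * a + 2) e with hP
  have hstep : ∀ u v, ¬ G.Adj u v → (P u ↔ P v) ∧ (¬ P u → c u = c v) := by
    intro u v huv
    by_cases h : c u = c v
    · simp [hP, h]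
    · have := mt (hjoin u v h) huv
      simp only [Set.mem_insert_iff, Set.mem_singleton_iff, not_or] at this
      simp only [hP]
      tauto
  have n1 : ¬ G.Adj v₀ w₀ := by simp [G, v₀, w₀, twoEdgesRemoved]
  have n2 : ¬ G.Adj w₀ w₁ := by simp [G, w₁, w₀, twoEdgesRemoved, hdiv, hdiv']
  have n3 : ¬ G.Adj w₁ v₁ := by simp [G, w₁, v₁, twoEdgesRemoved]
  have n4 : ¬ G.Adj v₁ v₂ := by simp [G, v₁, v₂, twoEdgesRemoved, hself, hself']
  have a1 : G.Adj v₀ v₂ := by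
    simp only [G, v₀, v₂, twoEdgesRemoved, hzero, hself']; omega
  have a2 : G.Adj v₀ w₁ := by
    simp only [G, v₀, w₁, twoEdgesRemoved, hzero, hdiv']; omega
  have a3 : G.Adj v₂ w₁ := by
    simp only [G, v₂, w₁, twoEdgesRemoved, hself', hdiv']; omega
  have s1 := hstep _ _ n1
  have s2 := hstep _ _ n2
  have s3 := hstep _ _ n3
  have s4 := hstep _ _ n4
  have p0 : P v₀ := by
    by_contra h
    have h1 : ¬ P w₀ := fun h' => h (s1.1.2 h')
    exact h (hindep v₀ w₁ a2 ((s1.2 h).trans (s2.2 h1)))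
  have pw : P w₁ := s2.1.1 (s1.1.1 p0)
  have p2 : P v₂ := s4.1.1 (s3.1.1 pw)
  classical
  refine hfree {⟨v₀, p0⟩, ⟨v₂, p2⟩, ⟨w₁, pw⟩} ?_
  rw [SimpleGraph.is3Clique_triple_iff]
  exact ⟨a1, a2, a3⟩

theorem kk_eq {n e s : ℕ} (hs : 0 < s) (hlt : tur s n < e) (hle : e ≤ tur (s + 1) n) :
    kk n e = s + 1 := by
  refine le_antisymm (Nat.sInf_le ⟨by omega, hle⟩) (le_csInf ⟨s + 1, by omega, hle⟩ ?_)
  rintro t ⟨ht, hte⟩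
  by_contra! h
  exact absurd (hte.trans (tur_mono ht (Nat.le_of_lt_succ h))) (by omega)

section Parameters

variable {p a : ℕ}

theorem tur_lt_edgeCnt_twoEdgesRemoved (hp : 1 ≤ p) (ha : 2 ≤ a) :
    tur (p + 1) ((p + 1) * a + 2) < edgeCnt (twoEdgesRemoved (p + 1) a ((p + 1) * a + 2)) := by
  have h1 := two_mul_edgeCnt_twoEdgesRemoved (q := p + 1) (by omega) ha
  have h2 := two_mul_tur (p := p) (t := 2) (by omega) a
  rw [Nat.choose_self] at h2
  nlinarith

theorem kk_twoEdgesRemoved (hp : 1 ≤ p) (ha : 2 ≤ a) :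
    kk ((p + 1) * a + 2) (edgeCnt (twoEdgesRemoved (p + 1) a ((p + 1) * a + 2))) = p + 2 :=
  kk_eq p.succ_pos (tur_lt_edgeCnt_twoEdgesRemoved hp ha)
    (edgeCnt_le_tur (by omega) ((twoEdgesRemoved_colorable ha).cliqueFree (by omega)))

theorem aLast_twoEdgesRemoved (hp : 1 ≤ p) (ha : 4 ≤ a) :
    aLast ((p + 1) * a + 2) (edgeCnt (twoEdgesRemoved (p + 1) a ((p + 1) * a + 2))) = 2 := by
  have h1 := two_mul_edgeCnt_twoEdgesRemoved (q := p + 1) (a := a) (by omega) (by omega)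
  have hmem : edgeCnt (twoEdgesRemoved (p + 1) a ((p + 1) * a + 2)) ≤
      2 * ((p + 1) * a + 2 - 2) + tur (p + 1) ((p + 1) * a + 2 - 2) := by
    have h2 := two_mul_tur (p := p) (t := 0) (by omega) a
    rw [Nat.add_sub_cancel]
    simp only [add_zero, Nat.choose_zero_succ, mul_zero] at h2
    nlinarith
  rw [aLast, kk_twoEdgesRemoved hp (by omega), show p + 2 - 1 = p + 1 by omega]
  refine le_antisymm (Nat.sInf_le ⟨by omega, hmem⟩) (le_csInf ⟨2, by omega, hmem⟩ ?_)
  rintro b ⟨hb, hbe⟩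
  by_contra! h
  obtain rfl : b = 1 := by omega
  have h2 := two_mul_tur (p := p) (t := 1) (by omega) a
  rw [show (p + 1) * a + 2 - 1 = (p + 1) * a + 1 by omega] at hbe
  simp only [Nat.choose_succ_self, mul_zero, mul_one, add_zero] at h2
  nlinarith

theorem aStar_twoEdgesRemoved_last (hp : 1 ≤ p) (ha : 4 ≤ a) :
    aStar ((p + 1) * a + 2) (edgeCnt (twoEdgesRemoved (p + 1) a ((p + 1) * a + 2))) (p + 2) =
      2 := by
  rw [aStar, kk_twoEdgesRemoved hp (by omega), if_pos rfl, aLast_twoEdgesRemoved hp ha]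

theorem aStar_twoEdgesRemoved (hp : 1 ≤ p) (ha : 4 ≤ a) {j : ℕ} (h1 : 1 ≤ j) (h2 : j ≤ p + 1) :
    aStar ((p + 1) * a + 2) (edgeCnt (twoEdgesRemoved (p + 1) a ((p + 1) * a + 2))) j = a := by
  rw [aStar, kk_twoEdgesRemoved hp (by omega), if_neg (by omega), aLast_twoEdgesRemoved hp ha,
    Nat.add_sub_cancel, show p + 2 - 1 = p + 1 by omega, Nat.mul_mod_right,
    if_neg (by omega), Nat.mul_div_cancel_left _ p.succ_pos, add_zero]

theorem memH2star_twoEdgesRemoved (hp : 1 ≤ p) (ha : 4 ≤ a) :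
    MemH2star ((p + 1) * a + 2) (edgeCnt (twoEdgesRemoved (p + 1) a ((p + 1) * a + 2)))
      (twoEdgesRemoved (p + 1) a ((p + 1) * a + 2)) := by
  have hqa : 2 * a ≤ (p + 1) * a := Nat.mul_le_mul_right a (by omega)
  have hdiv : (p + 1) * a / a = p + 1 := Nat.mul_div_cancel _ (by omega)
  have hdiv' : ((p + 1) * a + 1) / a = p + 1 := by rw [Nat.div_eq_iff (by omega)]; omega
  have hself : a / a = 1 := Nat.div_self (by omega)
  have hzero : 0 / a = 0 := Nat.zero_div a
  refine Or.inr ⟨rfl, fun v => v.val / a + 1, _,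
    fun v => if v.val = (p + 1) * a then 1 else 2, Or.inl fun _ => rfl, ?_⟩
  rw [kk_twoEdgesRemoved hp (by omega)]
  refine ⟨fun v => ?_, fun j hj => ?_, fun u v h => ?_, fun u v hne h hv => ?_,
    fun u v hne h => ?_⟩
  · have := block_le (by omega) v
    exact Finset.mem_Icc.2 ⟨Nat.succ_pos _, Nat.succ_le_succ this⟩
  · obtain ⟨hj1, hj2⟩ := Finset.mem_Icc.1 hj
    have hset : {v : Fin ((p + 1) * a + 2) | v.val / a + 1 = j} =
        (Finset.univ.filter fun v : Fin ((p + 1) * a + 2) => v.val / a = j - 1) := by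
      ext v
      simp only [Set.mem_ofPred_eq, Finset.coe_filter, Finset.mem_univ, true_and]
      omega
    rw [hset, Set.ncard_coe_finset]
    rcases hj2.eq_or_lt with rfl | hlt
    · rw [aStar_twoEdgesRemoved_last hp ha]
      exact card_last_block (by omega)
    · rw [aStar_twoEdgesRemoved hp ha hj1 (by omega)]
      exact card_block (q := p + 1) (by omega) (by omega) (by omega)
  · exact fun he => h.1 (Nat.succ_injective he)
  · have hne' : u.val / a ≠ v.val / a := fun he => hne (congrArg (· + 1) he)
    have hcases : (u.val = 0 ∧ v.val = (p + 1) * a) ∨ (v.val = 0 ∧ u.val = (p + 1) * a) ∨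
        (u.val = a ∧ v.val = (p + 1) * a + 1) ∨ (v.val = a ∧ u.val = (p + 1) * a + 1) := by
      simp only [twoEdgesRemoved] at h
      tauto
    simp only at hv
    have hlast := aStar_twoEdgesRemoved hp ha (j := p + 1) (by omega) le_rfl
    rw [show p + 2 - 1 = p + 1 by omega, hlast]
    rcases hcases with ⟨h1, h2⟩ | ⟨h1, h2⟩ | ⟨h1, h2⟩ | ⟨h1, h2⟩
    · simp only [h1, h2, hzero, if_true, zero_add, and_true]
      exact ⟨Finset.mem_Icc.2 (by omega), aStar_twoEdgesRemoved hp ha le_rfl (by omega)⟩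
    · rw [h1, hzero] at hv; omega
    · simp only [h1, h2, hself]
      rw [if_neg (by omega)]
      exact ⟨Finset.mem_Icc.2 (by omega), aStar_twoEdgesRemoved hp ha (by omega) (by omega), rfl⟩
    · rw [h1, hself] at hv; omega
  · have hne' : u.val / a ≠ v.val / a := fun he => hne (congrArg (· + 1) he)
    have hcases : (u.val = 0 ∧ v.val = (p + 1) * a) ∨ (v.val = 0 ∧ u.val = (p + 1) * a) ∨
        (u.val = a ∧ v.val = (p + 1) * a + 1) ∨ (v.val = a ∧ u.val = (p + 1) * a + 1) := by
      simp only [twoEdgesRemoved] at h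
      tauto
    rcases hcases with ⟨-, h2⟩ | ⟨-, h2⟩ | ⟨-, h2⟩ | ⟨-, h2⟩ <;> simp [h2, hdiv, hdiv']

end Parameters

/-- For every `r ≥ 4` there are infinitely many pairs `(n,e)` of positive
integers with `t_{r-1}(n) < e ≤ C(n,2)` such that `H_2*(n,e)` contains a graph that is not
isomorphic to any graph in `H_1*(n,e)` (both membership predicates are isomorphism-invariant). -/
theorem H2star_not_in_H1star_infinitely_often (r : ℕ) (hr : 4 ≤ r) :
    {p : ℕ × ℕ | 0 < p.1 ∧ 0 < p.2 ∧ tur (r - 1) p.1 < p.2 ∧ p.2 ≤ p.1.choose 2 ∧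
      ∃ G : SimpleGraph (Fin p.1), MemH2star p.1 p.2 G ∧ ¬ MemH1star p.1 p.2 G}.Infinite := by
  obtain ⟨p, rfl⟩ : ∃ p, r = p + 2 := ⟨r - 2, by omega⟩
  have hp : 1 ≤ p := by omega
  refine Set.infinite_of_injective_forall_mem (f := fun b : ℕ => ((p + 1) * (b + 4) + 2,
    edgeCnt (twoEdgesRemoved (p + 1) (b + 4) ((p + 1) * (b + 4) + 2)))) ?_ fun b => ?_
  · intro b b' h
    have h1 := Nat.eq_of_mul_eq_mul_left p.succ_pos (Nat.add_right_cancel (Prod.ext_iff.1 h).1)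
    omega
  · have hlt := tur_lt_edgeCnt_twoEdgesRemoved hp (show 2 ≤ b + 4 by omega)
    refine ⟨Nat.succ_pos _, by omega, hlt, ?_, _, memH2star_twoEdgesRemoved hp (by omega),
      not_memH1star_twoEdgesRemoved (by omega) (by omega) _⟩
    classical
    simp only [edgeCnt_eq_card_edgeFinset]
    exact SimpleGraph.card_edgeFinset_le_card_choose_two.trans_eq (by rw [Fintype.card_fin])
end

section
/- Let n, e be positive integers with e ≤ C(n,2), and let k = k(n,e), a*(n,e) = (a_1*, ..., a_k*) and m* = m*(n,e) be as defined. Then 0 ≤ m* ≤ a_{k−1}* − a_k*. -/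
theorem two_mul_sum_powersetCard_two_prod (S : Finset ℕ) (f : ℕ → ℤ) :
    2 * ∑ p ∈ S.powersetCard 2, ∏ i ∈ p, f i = (∑ i ∈ S, f i) ^ 2 - ∑ i ∈ S, f i ^ 2 := by
  induction S using Finset.induction_on with
  | empty => rw [Finset.powersetCard_eq_empty.2 (by simp)]; simp
  | insert x S hx ih =>
    have hdisj : Disjoint (S.powersetCard 2) ((S.powersetCard 1).image (insert x)) := by
      rw [Finset.disjoint_left]
      intro p hp hp'
      obtain ⟨t, -, rfl⟩ := Finset.mem_image.1 hp'
      exact hx ((Finset.mem_powersetCard.1 hp).1 (Finset.mem_insert_self x t))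
    have himage : ∑ p ∈ (S.powersetCard 1).image (insert x), ∏ i ∈ p, f i
        = f x * ∑ i ∈ S, f i := by
      rw [Finset.powersetCard_one, Finset.map_eq_image, Finset.image_image,
        Finset.sum_image, Finset.mul_sum]
      · refine Finset.sum_congr rfl fun y hy => ?_
        have hxy : x ≠ y := fun h => hx (h ▸ hy)
        simp [Finset.prod_pair hxy]
      · intro y hy z hz hyz
        have hxy : y ≠ x := fun h => hx (h ▸ hy)
        have : y ∈ ({x, z} : Finset ℕ) := by
          have h : ({x, y} : Finset ℕ) = {x, z} := hyz
          rw [← h]; simp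
        simpa [hxy] using this
    rw [Finset.powersetCard_succ_insert hx, Finset.sum_union hdisj, himage,
      Finset.sum_insert hx, Finset.sum_insert hx, mul_add, ih]
    ring

theorem sum_Icc_ite_le (s r : ℕ) (hr : r ≤ s) (x y : ℤ) :
    ∑ i ∈ Finset.Icc 1 s, (if i ≤ r then x else y) = r * x + (s - r) * y := by
  induction s, hr using Nat.le_induction with
  | base =>
    rw [Finset.sum_congr rfl fun i hi => if_pos (Finset.mem_Icc.1 hi).2]
    simp
  | succ s hs ih =>
    rw [Finset.sum_Icc_succ_top (by omega), ih, if_neg (by omega)]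
    push_cast
    ring

/-- The size of the Turán graph in terms of the quotient and remainder; the remainder is allowed
to equal the divisor. -/
theorem two_mul_tur_s5 (s q r : ℕ) (hs : 1 ≤ s) (hr : r ≤ s) :
    2 * (tur s (s * q + r) : ℤ) = s * (s - 1) * q ^ 2 + 2 * (s - 1) * q * r + r * (r - 1) := by
  have main : ∀ q r : ℕ, r < s →
      2 * (tur s (s * q + r) : ℤ)
        = s * (s - 1) * q ^ 2 + 2 * (s - 1) * q * r + r * (r - 1) := by
    intro q r hr
    have hcard : tur s (s * q + r) = ((s * q + r) ^ 2 - r ^ 2) * (s - 1) / (2 * s)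
        + r.choose 2 := by
      have hmod : (s * q + r) % s = r := by
        rw [Nat.mul_add_mod, Nat.mod_eq_of_lt hr]
      unfold tur edgeCnt
      rw [← SimpleGraph.coe_edgeFinset, Set.ncard_coe_finset,
        SimpleGraph.card_edgeFinset_turanGraph, hmod]
    obtain ⟨t, rfl⟩ : ∃ t, s = t + 1 := ⟨s - 1, by omega⟩
    obtain ⟨c, hc⟩ : 2 ∣ ((t + 1) * q ^ 2 + 2 * q * r) * t := by
      have h : 2 ∣ (t + 1) * t := by
        rw [mul_comm]; exact (Nat.even_mul_succ_self t).two_dvd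
      have : ((t + 1) * q ^ 2 + 2 * q * r) * t = (t + 1) * t * q ^ 2 + 2 * (q * r * t) := by ring
      rw [this]
      exact dvd_add (h.mul_right _) (dvd_mul_right _ _)
    have hdiv : (((t + 1) * q + r) ^ 2 - r ^ 2) * (t + 1 - 1) / (2 * (t + 1)) = c := by
      have h1 : ((t + 1) * q + r) ^ 2 - r ^ 2 = (t + 1) * ((t + 1) * q ^ 2 + 2 * q * r) := by
        rw [Nat.sub_eq_iff_eq_add (Nat.pow_le_pow_left (by omega) 2)]
        ring
      rw [h1, Nat.add_sub_cancel, mul_assoc, hc]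
      rw [show (t + 1) * (2 * c) = 2 * (t + 1) * c by ring]
      exact Nat.mul_div_cancel_left c (by omega)
    have hch : 2 * (r.choose 2 : ℤ) = r * (r - 1) := by
      cases r with
      | zero => simp
      | succ r =>
        have h2 : 2 * (r + 1).choose 2 = (r + 1) * r := by
          rw [Nat.choose_two_right, Nat.add_sub_cancel]
          exact Nat.mul_div_cancel' (by
            rw [mul_comm]; exact (Nat.even_mul_succ_self r).two_dvd)
        push_cast
        have h3 : (2 * ((r + 1).choose 2 : ℕ) : ℤ) = (r + 1) * r := by exact_mod_cast h2
        linarith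
    rw [hcard, hdiv]
    have hc' : (((t : ℤ) + 1) * q ^ 2 + 2 * q * r) * t = 2 * c := by exact_mod_cast hc
    push_cast
    linear_combination hch - hc'
  rcases hr.lt_or_eq with h | rfl
  · exact main q r h
  · have h := main (q + 1) 0 (by omega)
    rw [add_zero, mul_add, mul_one] at h
    rw [h]
    push_cast
    ring

theorem tur_succ (s N : ℕ) (hs : 1 ≤ s) :
    (tur s (N + 1) : ℤ) = tur s N + N - (N / s : ℕ) := by
  have hlt : N % s < s := Nat.mod_lt _ hs
  have h1 := two_mul_tur_s5 s (N / s) (N % s) hs hlt.le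
  have h2 := two_mul_tur_s5 s (N / s) (N % s + 1) hs hlt
  rw [← add_assoc, Nat.div_add_mod] at h2
  rw [Nat.div_add_mod] at h1
  have h3 : (s : ℤ) * (N / s : ℕ) + (N % s : ℕ) = N := by exact_mod_cast Nat.div_add_mod N s
  push_cast at h2 ⊢
  push_cast at h1 h3
  have h4 : 2 * (tur s (N + 1) : ℤ) = 2 * (tur s N + N - N / s) := by
    linear_combination h2 - h1 + 2 * h3
  linarith

theorem tur_one (N : ℕ) : tur 1 N = 0 := by
  have h := two_mul_tur_s5 1 N 0 le_rfl (by omega)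
  simpa using h

theorem choose_two_le_tur_self (n : ℕ) (hn : 0 < n) : n.choose 2 ≤ tur n n := by
  have h := two_mul_tur_s5 n 1 0 hn (by omega)
  rw [mul_one, add_zero] at h
  rw [Nat.choose_two_right]
  apply Nat.div_le_of_le_mul
  zify [hn]
  push_cast at h ⊢
  linarith

/-- Splitting off a smallest part of a Turán graph. -/
theorem tur_eq_mul_add_tur (k n : ℕ) (hk : 2 ≤ k) :
    tur k n = n / k * (n - n / k) + tur (k - 1) (n - n / k) := by
  obtain ⟨s, rfl⟩ : ∃ s, k = s + 1 := ⟨k - 1, by omega⟩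
  have hlt : n % (s + 1) < s + 1 := Nat.mod_lt _ (by omega)
  have h1 := two_mul_tur_s5 (s + 1) (n / (s + 1)) (n % (s + 1)) (by omega) hlt.le
  have h2 := two_mul_tur_s5 s (n / (s + 1)) (n % (s + 1)) (by omega) (by omega)
  have h3 := Nat.div_add_mod n (s + 1)
  rw [h3] at h1
  set q := n / (s + 1)
  set r := n % (s + 1)
  have h4 : n - q = s * q + r := by
    rw [← h3, add_mul, one_mul]; omega
  rw [Nat.add_sub_cancel, h4]
  zify
  push_cast at h1
  linarith

/-- The complete multipartite graph with one part of size `a`, and balanced other parts, loses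
edges as `a` decreases, by a controlled amount. -/
theorem mul_add_tur_sub (s M a : ℕ) (hs : 1 ≤ s) :
    (((a + 1) * M + tur s M : ℕ) : ℤ) - ((a * (M + 1) + tur s (M + 1) : ℕ) : ℤ)
      = (M / s : ℕ) - a := by
  push_cast
  have h := tur_succ s M hs
  push_cast at h
  rw [h]
  ring

theorem kk_mem (n e : ℕ) (hn : 0 < n) (he2 : e ≤ n.choose 2) :
    1 ≤ kk n e ∧ e ≤ tur (kk n e) n :=
  Nat.sInf_mem (s := {s : ℕ | 1 ≤ s ∧ e ≤ tur s n})
    ⟨n, hn, he2.trans (choose_two_le_tur_self n hn)⟩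

theorem kk_le (n e : ℕ) (hn : 0 < n) (he2 : e ≤ n.choose 2) : kk n e ≤ n :=
  Nat.sInf_le ⟨hn, he2.trans (choose_two_le_tur_self n hn)⟩

theorem two_le_kk (n e : ℕ) (hn : 0 < n) (he1 : 1 ≤ e) (he2 : e ≤ n.choose 2) :
    2 ≤ kk n e := by
  obtain ⟨h1, h2⟩ := kk_mem n e hn he2
  by_contra! h
  rw [show kk n e = 1 by omega, tur_one] at h2
  omega

theorem tur_kk_sub_one_lt (n e : ℕ) (hn : 0 < n) (he1 : 1 ≤ e) (he2 : e ≤ n.choose 2) :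
    tur (kk n e - 1) n < e := by
  have hk := two_le_kk n e hn he1 he2
  by_contra! h
  have : kk n e ≤ kk n e - 1 := Nat.sInf_le ⟨by omega, h⟩
  omega

theorem aLast_mem (n e : ℕ) (hn : 0 < n) (he1 : 1 ≤ e) (he2 : e ≤ n.choose 2) :
    1 ≤ aLast n e ∧
      e ≤ aLast n e * (n - aLast n e) + tur (kk n e - 1) (n - aLast n e) := by
  have hk := two_le_kk n e hn he1 he2
  refine Nat.sInf_mem
    (s := {a : ℕ | 1 ≤ a ∧ e ≤ a * (n - a) + tur (kk n e - 1) (n - a)}) ⟨n / kk n e, ?_, ?_⟩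
  · exact Nat.div_pos (kk_le n e hn he2) (by omega)
  · rw [← tur_eq_mul_add_tur _ _ hk]
    exact (kk_mem n e hn he2).2

theorem aLast_lt (n e : ℕ) (hn : 0 < n) (he1 : 1 ≤ e) (he2 : e ≤ n.choose 2) :
    aLast n e < n := by
  have hk := two_le_kk n e hn he1 he2
  obtain ⟨-, h⟩ := aLast_mem n e hn he1 he2
  by_contra! hle
  have h0 := two_mul_tur_s5 (kk n e - 1) 0 0 (by omega) (by omega)
  rw [Nat.sub_eq_zero_of_le hle] at h
  simp at h0
  omega

theorem mul_add_tur_lt_of_lt_aLast (n e a : ℕ) (hn : 0 < n) (he1 : 1 ≤ e)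
    (he2 : e ≤ n.choose 2) (ha : a < aLast n e) :
    a * (n - a) + tur (kk n e - 1) (n - a) < e := by
  rcases a.eq_zero_or_pos with rfl | hpos
  · simpa using tur_kk_sub_one_lt n e hn he1 he2
  · by_contra! h
    exact absurd (Nat.sInf_le ⟨hpos, h⟩ : aLast n e ≤ a) ha.not_ge

theorem mStarZ_eq (n e : ℕ) (hk : 2 ≤ kk n e) :
    mStarZ n e
      = ((aLast n e * (n - aLast n e) + tur (kk n e - 1) (n - aLast n e) : ℕ) : ℤ) - e := by
  unfold mStarZ
  congr 1
  have htwo := two_mul_sum_powersetCard_two_prod (Finset.Icc 1 (kk n e))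
    (fun i => (aStar n e i : ℤ))
  obtain ⟨s, hs⟩ : ∃ s, kk n e = s + 1 := ⟨kk n e - 1, by omega⟩
  set M := n - aLast n e with hM
  have hlt : M % s < s := Nat.mod_lt _ (by omega)
  have hval : ∀ i ∈ Finset.Icc 1 s, (aStar n e i : ℤ)
      = if i ≤ M % s then ((M / s : ℕ) : ℤ) + 1 else ((M / s : ℕ) : ℤ) := by
    intro i hi
    have hi' := (Finset.mem_Icc.1 hi).2
    unfold aStar
    rw [if_neg (by omega), hs, Nat.add_sub_cancel, ← hM]
    split_ifs <;> simp
  have hlast : aStar n e (s + 1) = aLast n e := by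
    unfold aStar; rw [if_pos hs.symm]
  have hsq : ∀ i ∈ Finset.Icc 1 s, (aStar n e i : ℤ) ^ 2
      = if i ≤ M % s then (((M / s : ℕ) : ℤ) + 1) ^ 2 else ((M / s : ℕ) : ℤ) ^ 2 := by
    intro i hi
    rw [hval i hi]
    split_ifs <;> rfl
  rw [hs, Finset.sum_Icc_succ_top (by omega), Finset.sum_Icc_succ_top (by omega), hlast,
    Finset.sum_congr rfl hval, Finset.sum_congr rfl hsq, sum_Icc_ite_le _ _ hlt.le,
    sum_Icc_ite_le _ _ hlt.le] at htwo
  rw [hs, Nat.add_sub_cancel]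
  have ht := two_mul_tur_s5 s (M / s) (M % s) (by omega) hlt.le
  have hdm := Nat.div_add_mod M s
  rw [hdm] at ht
  zify at hdm
  have hfin : 2 * ∑ p ∈ (Finset.Icc 1 (s + 1)).powersetCard 2, ∏ i ∈ p, (aStar n e i : ℤ)
      = 2 * ((aLast n e * M + tur s M : ℕ) : ℤ) := by
    push_cast at htwo ht ⊢
    linear_combination htwo - ht + 2 * (aLast n e : ℤ) * hdm
  linarith

/-- (Fact (i)) For positive integers `n, e` with `e ≤ C(n,2)`:
`0 ≤ m* ≤ a_{k-1}* - a_k*`. -/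
theorem mStar_nonneg_le (n e : ℕ) (hn : 0 < n) (he1 : 1 ≤ e) (he2 : e ≤ n.choose 2) :
    0 ≤ mStarZ n e ∧
      mStarZ n e ≤ (aStar n e (kk n e - 1) : ℤ) - (aStar n e (kk n e) : ℤ) := by
  have hk := two_le_kk n e hn he1 he2
  obtain ⟨ha1, ha⟩ := aLast_mem n e hn he1 he2
  have han := aLast_lt n e hn he1 he2
  have hprev := mul_add_tur_lt_of_lt_aLast n e (aLast n e - 1) hn he1 he2 (by omega)
  have hlast : aStar n e (kk n e) = aLast n e := if_pos rfl
  have hpen : aStar n e (kk n e - 1) = (n - aLast n e) / (kk n e - 1) := by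
    have hlt : (n - aLast n e) % (kk n e - 1) < kk n e - 1 := Nat.mod_lt _ (by omega)
    unfold aStar
    rw [if_neg (by omega), if_neg (by omega), add_zero]
  rw [mStarZ_eq n e hk, hlast, hpen]
  have hstep := mul_add_tur_sub (kk n e - 1) (n - aLast n e) (aLast n e - 1) (by omega)
  rw [Nat.sub_add_cancel ha1, show n - aLast n e + 1 = n - (aLast n e - 1) by omega] at hstep
  omega
end

section
/- Let r ≥ 1 be an integer, let G be a finite graph, let S ⊆ V(G) and S̄ := V(G) \ S. Suppose that the induced subgraph G[S] is triangle-free and that every vertex of S is adjacent in G to every vertex of S̄. Then N(K_r, G) = e(G[S]) · N(K_{r−2}, G[S̄]) + |S| · N(K_{r−1}, G[S̄]) + N(K_r, G[S̄]), where e(G[S]) is the number of edges of G[S], and with the conventions N(K_0, H) = 1 and N(K_{−1}, H) = 0 for every graph H. -/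
open Finset in
/-- A clique of a join splits into a clique on each side, and conversely. -/
theorem NK_eq_sum_antidiagonal_of_join {V : Type*} [Finite V] (G : SimpleGraph V) (r : ℕ)
    (S : Set V) (hcomp : ∀ u ∈ S, ∀ v ∈ Sᶜ, G.Adj u v) :
    NK G r = ∑ p ∈ antidiagonal r, NK (G.induce S) p.1 * NK (G.induce Sᶜ) p.2 := by
  classical
  have := Fintype.ofFinite V
  have hNK {W : Type _} [Fintype W] (H : SimpleGraph W) (k : ℕ) :
      NK H k = #{s : Finset W | H.IsNClique k s} := by
    rw [NK, ← Set.ncard_coe_finset]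
    simp
  let parts (s : Finset V) : Finset S × Finset (Sᶜ : Set V) :=
    (s.subtype (· ∈ S), s.subtype (· ∈ Sᶜ))
  let glue (p : Finset S × Finset (Sᶜ : Set V)) : Finset V :=
    p.1.map (.subtype _) ∪ p.2.map (.subtype _)
  have glue_parts (s : Finset V) : glue (parts s) = s := by
    ext v
    by_cases hv : v ∈ S <;> simp [glue, parts, hv]
  have parts_glue (p : Finset S × Finset (Sᶜ : Set V)) : parts (glue p) = p := by
    refine Prod.ext ?_ ?_ <;> ext ⟨v, hv⟩
    · have : v ∈ S := hv
      simp [glue, parts, this]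
    · have : v ∉ S := hv
      simp [glue, parts, this]
  have card_glue (p : Finset S × Finset (Sᶜ : Set V)) : #(glue p) = #p.1 + #p.2 := by
    rw [card_union_of_disjoint, card_map, card_map]
    rw [disjoint_left]
    intro v h1 h2
    simp only [mem_map, Function.Embedding.subtype_apply] at h1 h2
    obtain ⟨⟨a, ha⟩, -, rfl⟩ := h1
    obtain ⟨⟨b, hb⟩, -, hab⟩ := h2
    exact hb ((show b = a from hab) ▸ ha)
  have isClique_glue (p : Finset S × Finset (Sᶜ : Set V)) :
      G.IsClique (glue p) ↔ (G.induce S).IsClique p.1 ∧ (G.induce Sᶜ).IsClique p.2 := by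
    constructor
    · refine fun h ↦ ⟨fun a ha b hb hab ↦ ?_, fun a ha b hb hab ↦ ?_⟩
      · exact h (mem_union_left _ (mem_map_of_mem _ ha)) (mem_union_left _ (mem_map_of_mem _ hb))
          fun h ↦ hab (Subtype.ext h)
      · exact h (mem_union_right _ (mem_map_of_mem _ ha)) (mem_union_right _ (mem_map_of_mem _ hb))
          fun h ↦ hab (Subtype.ext h)
    · rintro ⟨h1, h2⟩ u hu v hv huv
      simp only [glue, coe_union, coe_map, Set.mem_union, Set.mem_image, mem_coe,
        Function.Embedding.subtype_apply] at hu hv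
      obtain ⟨a, ha, rfl⟩ | ⟨a, ha, rfl⟩ := hu <;> obtain ⟨b, hb, rfl⟩ | ⟨b, hb, rfl⟩ := hv
      · exact h1 ha hb (fun h ↦ huv (congrArg _ h))
      · exact hcomp _ a.2 _ b.2
      · exact (hcomp _ b.2 _ a.2).symm
      · exact h2 ha hb (fun h ↦ huv (congrArg _ h))
  rw [hNK, card_eq_sum_card_fiberwise (f := fun s ↦ (#(parts s).1, #(parts s).2))
    (t := antidiagonal r)]
  · refine sum_congr rfl fun p hp ↦ ?_
    rw [hNK, hNK, ← card_product]
    refine card_nbij' parts glue ?_ ?_ (fun s _ ↦ glue_parts s) (fun q _ ↦ parts_glue q)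
    · intro s hs
      simp only [coe_filter, mem_filter, mem_univ, true_and, Set.mem_ofPred_eq, coe_product,
        Set.mem_prod, SimpleGraph.isNClique_iff] at hs ⊢
      have := (isClique_glue (parts s)).1 (by rw [glue_parts]; exact hs.1.1)
      exact ⟨⟨this.1, congrArg Prod.fst hs.2⟩, ⟨this.2, congrArg Prod.snd hs.2⟩⟩
    · intro q hq
      simp only [coe_filter, mem_filter, mem_univ, true_and, Set.mem_ofPred_eq, coe_product,
        Set.mem_prod, SimpleGraph.isNClique_iff] at hq ⊢
      refine ⟨⟨(isClique_glue q).2 ⟨hq.1.1, hq.2.1⟩, ?_⟩, ?_⟩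
      · rw [card_glue, hq.1.2, hq.2.2, HasAntidiagonal.mem_antidiagonal.1 hp]
      · rw [parts_glue, hq.1.2, hq.2.2]
  · intro s hs
    simp only [coe_filter, mem_univ, true_and, Set.mem_ofPred_eq, SimpleGraph.isNClique_iff] at hs
    rw [mem_coe, HasAntidiagonal.mem_antidiagonal, ← card_glue, glue_parts, hs.2]

theorem NK_zero {V : Type*} (G : SimpleGraph V) : NK G 0 = 1 := by
  simp [NK]

theorem NK_one {V : Type*} (G : SimpleGraph V) : NK G 1 = Nat.card V := by
  have : {s : Finset V | G.IsNClique 1 s} = Set.range singleton := G.cliqueSet_one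
  rw [NK, this, ← Set.image_univ, Set.ncard_image_of_injective _ Finset.singleton_injective,
    Set.ncard_univ]

theorem NK_two {V : Type*} (G : SimpleGraph V) : NK G 2 = edgeCnt G := by
  classical
  have himage : {s : Finset V | G.IsNClique 2 s} = Sym2.toFinset '' G.edgeSet := by
    ext s
    constructor
    · rintro ⟨hs, hcard⟩
      obtain ⟨a, b, hab, rfl⟩ := Finset.card_eq_two.1 hcard
      exact ⟨s(a, b), hs (by simp) (by simp) hab, Sym2.toFinset_mk_eq⟩
    · rintro ⟨e, he, rfl⟩
      induction e with | _ a b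
      have hab : G.Adj a b := he
      rw [Sym2.toFinset_mk_eq]
      refine ⟨?_, Finset.card_pair hab.ne⟩
      simp [SimpleGraph.isClique_iff, Set.pairwise_insert, hab, hab.symm]
  have hinj : Function.Injective (Sym2.toFinset : Sym2 V → Finset V) := fun e f h ↦
    Sym2.ext fun x ↦ by rw [← Sym2.mem_toFinset, h, Sym2.mem_toFinset]
  rw [NK, himage, Set.ncard_image_of_injective _ hinj, edgeCnt]

theorem NK_eq_zero_of_cliqueFree {V : Type*} {G : SimpleGraph V} {m n : ℕ} (hmn : m ≤ n)
    (hG : G.CliqueFree m) : NK G n = 0 := by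
  have : {s : Finset V | G.IsNClique n s} = ∅ :=
    Set.eq_empty_of_forall_notMem (hG.mono hmn)
  rw [NK, this, Set.ncard_empty]

/-- (Fact 2.2) If `G[S]` is triangle-free and every vertex of `S` is
adjacent to every vertex of `S̄ := V ∖ S`, then for every `r ≥ 1`,
`N(K_r, G) = e(G[S])·N(K_{r-2}, G[S̄]) + |S|·N(K_{r-1}, G[S̄]) + N(K_r, G[S̄])`
(with `N(K_0, H) = 1` and `N(K_{-1}, H) = 0`). -/
theorem clique_count_one_part {V : Type*} [Fintype V] (G : SimpleGraph V) (r : ℕ)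
    (hr : 1 ≤ r) (S : Set V)
    (hS : (G.induce S).CliqueFree 3)
    (hcomp : ∀ u ∈ S, ∀ v ∈ Sᶜ, G.Adj u v) :
    NK G r =
      edgeCnt (G.induce S) * NKZ (G.induce Sᶜ) ((r : ℤ) - 2) +
        S.ncard * NKZ (G.induce Sᶜ) ((r : ℤ) - 1) +
        NK (G.induce Sᶜ) r := by
  rw [NK_eq_sum_antidiagonal_of_join G r S hcomp, Finset.Nat.sum_antidiagonal_eq_sum_range_succ_mk]
  have hcard : NK (G.induce S) 1 = S.ncard := by rw [NK_one, Nat.card_coe_set_eq]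
  obtain _ | _ | n := r
  · omega
  · simp [Finset.sum_range_succ, NKZ, NK_zero, hcard, add_comm]
  · have h2 : NKZ (G.induce Sᶜ) (((n + 1 + 1 : ℕ) : ℤ) - 2) = NK (G.induce Sᶜ) n := by
      rw [NKZ, if_neg (by omega)]
      congr 1
      omega
    have h1 : NKZ (G.induce Sᶜ) (((n + 1 + 1 : ℕ) : ℤ) - 1) = NK (G.induce Sᶜ) (n + 1) := by
      rw [NKZ, if_neg (by omega)]
      congr 1
      omega
    rw [h1, h2, Finset.sum_range_succ', Finset.sum_range_succ', Finset.sum_range_succ',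
      Finset.sum_eq_zero fun k _ ↦ by rw [NK_eq_zero_of_cliqueFree (by omega) hS, zero_mul]]
    simp [NK_zero, NK_two, hcard]
end
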